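/- arXiv:2302.02673 — 3 statements merged into one kernel-verified Lean document; each statement's English description precedes it below -/
import Mathlib

section
/- Let μ > 0 and let (ℏ_N)_{N≥1} be a sequence of positive numbers with N·ℏ_N → μ as N → ∞. For each N let y_N^{(1)}, …, y_N^{(N)} be the N zeros of the function y ↦ h_N(y/√ℏ_N) (these are √ℏ_N times the zeros of the N-th physicists' Hermite polynomial h_N). Then for every bounded continuous function f : ℝ → ℝ, (1/N) Σ_{j=1}^N f(y_N^{(j)}) → ∫_ℝ f(y) ρ_μ(y) dy as N → ∞, where ρ_μ(y) = (1/(πμ)) √(max(2μ − y², 0)) is the semicircular density. -/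
open MeasureTheory Filter

/-- Physicists' Hermite polynomial `h_k(y) = (-1)^k e^{y^2} (d/dy)^k e^{-y^2}`. -/
noncomputable def hermiteH (k : ℕ) (y : ℝ) : ℝ :=
  (-1)^k * Real.exp (y^2) * iteratedDeriv k (fun t => Real.exp (-t^2)) y

/-- The semicircular density `ρ_μ(y) = (1/(πμ))√((2μ - y²)₊)` of radius `√(2μ)`. -/
noncomputable def rhoSC (μ y : ℝ) : ℝ :=
  (1 / (Real.pi * μ)) * Real.sqrt (max (2*μ - y^2) 0)

open Polynomial in
/-- Physicists' Hermite polynomials as polynomials. -/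
noncomputable def hermP : ℕ → Polynomial ℝ
  | 0 => 1
  | n + 1 => 2 * X * hermP n - derivative (hermP n)

theorem hermP_iter (n : ℕ) : iteratedDeriv n (fun t : ℝ => Real.exp (-t^2)) =
    fun y => (-1)^n * (hermP n).eval y * Real.exp (-y^2) := by
  induction n with
  | zero => ext y; simp [hermP]
  | succ n ih =>
    rw [iteratedDeriv_succ, ih]
    ext y
    have h1 : HasDerivAt (fun t : ℝ => Real.exp (-t^2)) (Real.exp (-y^2) * (-(2*y))) y := by
      have : HasDerivAt (fun t : ℝ => -t^2) (-(2*y)) y := by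
        simpa using (hasDerivAt_pow 2 y).fun_neg
      exact this.exp
    have h2 := (((hermP n).hasDerivAt y).const_mul ((-1 : ℝ)^n)).mul h1
    have h3 := h2.deriv
    simp only [Pi.mul_def] at h3
    rw [h3]
    simp [hermP]
    ring

theorem hermiteH_eq (n : ℕ) (y : ℝ) : hermiteH n y = (hermP n).eval y := by
  unfold hermiteH
  rw [hermP_iter]
  have h : Real.exp (y^2) * Real.exp (-y^2) = 1 := by
    rw [← Real.exp_add]; simp
  have h' : ((-1 : ℝ)^n) * (-1)^n = 1 := by
    rw [← mul_pow]; simp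
  calc _ = (((-1 : ℝ)^n) * (-1)^n) * (Real.exp (y^2) * Real.exp (-y^2)) * (hermP n).eval y := by ring
    _ = _ := by rw [h, h']; ring

open Polynomial in
theorem hermP_ode (n : ℕ) : derivative (derivative (hermP n)) =
    2 * X * derivative (hermP n) - 2 * (n : Polynomial ℝ) * hermP n := by
  induction n with
  | zero => simp [hermP]
  | succ n ih =>
    have h1 : derivative (hermP (n+1)) = 2 * ((n : Polynomial ℝ) + 1) * hermP n := by
      rw [hermP]
      simp only [derivative_sub, derivative_mul, derivative_X, ih, derivative_ofNat]
      ring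
    rw [h1]
    have h2 : derivative (2 * ((n : Polynomial ℝ) + 1) * hermP n)
        = 2 * ((n : Polynomial ℝ) + 1) * derivative (hermP n) := by
      simp [derivative_mul]
    rw [h2, hermP]
    push_cast
    ring

open Polynomial in
theorem hermP_deg (n : ℕ) : (hermP n).natDegree ≤ n ∧ (hermP n).coeff n = 2^n := by
  induction n with
  | zero => simp [hermP]
  | succ n ih =>
    obtain ⟨hd, hc⟩ := ih
    have hd' : (derivative (hermP n)).natDegree ≤ n :=
      (natDegree_derivative_le _).trans (by omega)
    constructor
    · rw [hermP]
      refine (natDegree_sub_le _ _).trans (max_le ?_ (by omega))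
      have : (2 * X * hermP n : ℝ[X]) = C 2 * (X * hermP n) := by
        rw [← mul_assoc]; rfl
      rw [this]
      refine (natDegree_C_mul_le _ _).trans ?_
      refine natDegree_mul_le.trans ?_
      rw [natDegree_X]; omega
    · rw [hermP]
      have : (2 * X * hermP n : ℝ[X]) = C 2 * (X * hermP n) := by
        rw [← mul_assoc]; rfl
      rw [this, coeff_sub, coeff_C_mul, coeff_X_mul, hc,
        coeff_eq_zero_of_natDegree_lt (lt_of_le_of_lt hd' (by omega))]
      ring

open Polynomial in
theorem hermP_prod (N : ℕ) (x : Fin N → ℝ) (hx : ∀ j, (hermP N).eval (x j) = 0)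
    (hinj : Function.Injective x) : hermP N = C (2^N : ℝ) * ∏ j, (X - C (x j)) := by
  obtain ⟨hd, hc⟩ := hermP_deg N
  have hne : hermP N ≠ 0 := by
    intro h; rw [h] at hc; simp at hc
    exact absurd hc.symm (by positivity)
  have hmon : (∏ j, (X - C (x j))).Monic := monic_prod_of_monic _ _ fun j _ => monic_X_sub_C _
  have hdvd : (∏ j, (X - C (x j))) ∣ hermP N := by
    refine Finset.prod_dvd_of_coprime ?_ fun j _ => dvd_iff_isRoot.mpr (hx j)
    intro i _ j _ hij
    exact pairwise_coprime_X_sub_C hinj hij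
  have hdeg : (∏ j, (X - C (x j))).natDegree = N := by
    rw [natDegree_prod_of_monic _ _ fun j _ => monic_X_sub_C _]; simp
  have hN : (hermP N).natDegree = N :=
    le_antisymm hd (le_natDegree_of_ne_zero (by rw [hc]; positivity))
  have := eq_leadingCoeff_mul_of_monic_of_dvd_of_natDegree_le hmon hdvd (by omega)
  rw [leadingCoeff, hN, hc] at this
  exact this

open Polynomial in
theorem stieltjes (N : ℕ) (x : Fin N → ℝ) (hx : ∀ j, (hermP N).eval (x j) = 0)
    (hinj : Function.Injective x) (j : Fin N) : ∑ k, 1 / (x j - x k) = x j := by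
  classical
  have hP := hermP_prod N x hx hinj
  set Q : ℝ[X] := C (2^N : ℝ) * ∏ k ∈ Finset.univ.erase j, (X - C (x k)) with hQ
  have hPQ : hermP N = (X - C (x j)) * Q := by
    rw [hP, ← Finset.mul_prod_erase Finset.univ _ (Finset.mem_univ j), hQ]; ring
  have hode := congrArg (eval (x j)) (hermP_ode N)
  have e1 : (derivative (hermP N)).eval (x j) = Q.eval (x j) := by
    rw [hPQ]; simp
  have e2 : (derivative (derivative (hermP N))).eval (x j) = 2 * (derivative Q).eval (x j) := by
    rw [hPQ]; simp; ring
  rw [e2] at hode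
  simp only [eval_sub, eval_mul, eval_X, e1, hx j, eval_ofNat, mul_zero, sub_zero] at hode
  have hQne : Q.eval (x j) ≠ 0 := by
    rw [hQ, eval_mul, eval_prod]
    refine mul_ne_zero (by simp) (Finset.prod_ne_zero_iff.mpr ?_)
    intro k hk
    simp only [eval_sub, eval_X, eval_C]
    exact sub_ne_zero.mpr fun h => (Finset.ne_of_mem_erase hk) (hinj h).symm
  have hQ' : (derivative Q).eval (x j) = Q.eval (x j) * ∑ k, 1 / (x j - x k) := by
    rw [← Finset.add_sum_erase Finset.univ _ (Finset.mem_univ j)]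
    simp only [sub_self, div_zero, zero_add]
    rw [hQ]
    simp only [derivative_C_mul, eval_mul, eval_C]
    rw [derivative_prod_finset, eval_finsetSum, mul_assoc, Finset.mul_sum (f := fun k => 1 / (x j - x k))]
    congr 1
    refine Finset.sum_congr rfl fun k hk => ?_
    have hk0 : x j - x k ≠ 0 :=
      sub_ne_zero.mpr fun h => (Finset.ne_of_mem_erase hk) (hinj h).symm
    rw [← Finset.mul_prod_erase _ _ hk]
    simp only [eval_mul, eval_sub, eval_X, eval_C, derivative_X_sub_C, eval_one]
    field_simp
  rw [hQ'] at hode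
  have : Q.eval (x j) * (∑ k, 1 / (x j - x k) - x j) = 0 := by linarith
  rcases mul_eq_zero.mp this with h | h
  · exact absurd h hQne
  · linarith

theorem stieltjes_scaled (N : ℕ) (h : ℝ) (hh : 0 < h) (y : Fin N → ℝ)
    (hy : ∀ j, hermiteH N (y j / Real.sqrt h) = 0)
    (hinj : Function.Injective y) (j : Fin N) : y j = h * ∑ k, 1 / (y j - y k) := by
  have hs : 0 < Real.sqrt h := Real.sqrt_pos.mpr hh
  have := stieltjes N (fun j => y j / Real.sqrt h) (fun j => by rw [← hermiteH_eq]; exact hy j)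
    (fun a b hab => hinj (by
      simp only at hab
      field_simp at hab
      exact hab)) j
  simp only [← sub_div, one_div_div] at this
  have h2 : y j = Real.sqrt h * ∑ k, Real.sqrt h / (y j - y k) := by
    rw [this]; field_simp
  refine h2.trans ?_
  rw [Finset.mul_sum, Finset.mul_sum]
  refine Finset.sum_congr rfl fun k _ => ?_
  have := Real.mul_self_sqrt hh.le
  rw [mul_div_assoc', this, mul_one_div]

theorem power_sum_one (N : ℕ) (h : ℝ) (y : Fin N → ℝ)
    (hs : ∀ j, y j = h * ∑ k, 1 / (y j - y k)) : ∑ j, y j = 0 := by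
  have h1 : ∑ j, y j = h * ∑ j, ∑ k, 1 / (y j - y k) := by
    rw [Finset.mul_sum]; exact Finset.sum_congr rfl fun j _ => hs j
  have h2 : ∑ j, ∑ k, 1 / (y j - y k) = - ∑ j, ∑ k, 1 / (y j - y k) := by
    conv_lhs => rw [Finset.sum_comm]
    simp only [← Finset.sum_neg_distrib]
    refine Finset.sum_congr rfl fun j _ => Finset.sum_congr rfl fun k _ => ?_
    rw [← neg_sub (y j) (y k), one_div, one_div, inv_neg]
  have h3 : ∑ j, ∑ k, 1 / (y j - y k) = 0 := by linarith
  rw [h1, h3, mul_zero]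

theorem power_sum_rec (N : ℕ) (h : ℝ) (y : Fin N → ℝ) (hinj : Function.Injective y)
    (hs : ∀ j, y j = h * ∑ k, 1 / (y j - y k)) (m : ℕ) :
    2 * ∑ j, y j ^ (m+2) = h * (∑ i ∈ Finset.range (m+1), (∑ j, y j ^ i) * (∑ j, y j ^ (m - i))
      - (m+1) * ∑ j, y j ^ m) := by
  classical
  have h1 : ∑ j, y j ^ (m+2) = h * ∑ j, ∑ k, y j ^ (m+1) / (y j - y k) := by
    rw [Finset.mul_sum]
    refine Finset.sum_congr rfl fun j _ => ?_
    rw [pow_succ]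
    nth_rewrite 2 [hs j]
    rw [Finset.mul_sum, Finset.mul_sum, Finset.mul_sum]
    refine Finset.sum_congr rfl fun k _ => ?_
    ring
  have h2 : ∑ j, ∑ k, y j ^ (m+1) / (y j - y k) = ∑ j, ∑ k, - (y k ^ (m+1) / (y j - y k)) := by
    conv_lhs => rw [Finset.sum_comm]
    refine Finset.sum_congr rfl fun j _ => Finset.sum_congr rfl fun k _ => ?_
    rw [← neg_sub (y j) (y k), div_neg]
  have h3 : 2 * ∑ j, ∑ k, y j ^ (m+1) / (y j - y k)
      = ∑ j, ∑ k, (∑ i ∈ Finset.range (m+1), y j ^ i * y k ^ (m - i)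
          - if j = k then ((m:ℝ)+1) * y j ^ m else 0) := by
    rw [two_mul]
    nth_rewrite 2 [h2]
    rw [← Finset.sum_add_distrib]
    refine Finset.sum_congr rfl fun j _ => ?_
    rw [← Finset.sum_add_distrib]
    refine Finset.sum_congr rfl fun k _ => ?_
    by_cases hjk : j = k
    · subst hjk
      simp only [sub_self, div_zero, if_true, neg_zero, add_zero]
      have : ∑ i ∈ Finset.range (m+1), y j ^ i * y j ^ (m - i)
          = ∑ i ∈ Finset.range (m+1), y j ^ m := by
        refine Finset.sum_congr rfl fun i hi => ?_
        rw [← pow_add]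
        congr 1
        have := Finset.mem_range.mp hi
        omega
      rw [this]; simp
    · have hne : y j - y k ≠ 0 := sub_ne_zero.mpr fun h => hjk (hinj h)
      have hg := geom_sum₂_mul (y j) (y k) (m+1)
      simp only [Nat.add_sub_cancel] at hg
      rw [if_neg hjk, sub_zero, ← sub_eq_add_neg, ← sub_div, ← hg]
      field_simp
  calc 2 * ∑ j, y j ^ (m+2) = h * (2 * ∑ j, ∑ k, y j ^ (m+1) / (y j - y k)) := by rw [h1]; ring
    _ = _ := by
      rw [h3]
      congr 1
      simp only [Finset.sum_sub_distrib]
      congr 1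
      · simp only [Finset.sum_mul_sum]
        symm
        rw [Finset.sum_comm]
        refine Finset.sum_congr rfl fun j _ => ?_
        rw [Finset.sum_comm]
      · simp [Finset.mul_sum]

theorem rho_cont (μ : ℝ) : Continuous (rhoSC μ) := by
  unfold rhoSC; fun_prop

theorem rho_nonneg (μ : ℝ) (hμ : 0 < μ) (t : ℝ) : 0 ≤ rhoSC μ t := by
  unfold rhoSC; positivity

theorem rho_integral (μ : ℝ) (f : ℝ → ℝ) :
    ∫ t, f t * rhoSC μ t = ∫ t in (-√(2*μ))..(√(2*μ)), f t * rhoSC μ t := by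
  symm
  refine intervalIntegral.integral_eq_integral_of_support_subset ?_
  intro t ht
  have h1 : rhoSC μ t ≠ 0 := fun h => ht (by simp [h])
  have h2 : 0 < 2*μ - t^2 := by
    by_contra hc
    push Not at hc
    exact h1 (by unfold rhoSC; rw [max_eq_right hc]; simp)
  have := abs_lt.mp (Real.lt_sqrt_of_sq_lt (show |t|^2 < 2*μ by rw [sq_abs]; linarith))
  exact ⟨this.1, this.2.le⟩

/-- Moments of the semicircle. -/
noncomputable def smom (μ : ℝ) (m : ℕ) : ℝ := ∫ t, t^m * rhoSC μ t

theorem smom_eq (μ : ℝ) (hμ : 0 < μ) (m : ℕ) :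
    smom μ m = (1 / (Real.pi * μ)) * ∫ t in (-√(2*μ))..(√(2*μ)), t^m * √(2*μ - t^2) := by
  unfold smom
  rw [rho_integral, ← intervalIntegral.integral_const_mul]
  refine intervalIntegral.integral_congr fun t ht => ?_
  have hR : 0 ≤ √(2*μ) := Real.sqrt_nonneg _
  rw [Set.uIcc_of_le (by linarith)] at ht
  have h2 : t^2 ≤ 2*μ := by
    rw [← Real.sqrt_le_sqrt_iff (by positivity), Real.sqrt_sq_eq_abs]
    exact abs_le.mpr ht
  simp only [rhoSC]
  rw [max_eq_left (by linarith)]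
  ring

theorem smom_zero (μ : ℝ) (hμ : 0 < μ) : smom μ 0 = 1 := by
  rw [smom_eq μ hμ]
  have hR : 0 < √(2*μ) := Real.sqrt_pos.mpr (by positivity)
  have h := intervalIntegral.integral_comp_mul_left (a := -1) (b := 1)
    (fun t => √(2*μ - t^2)) hR.ne'
  have h2 : ∀ x : ℝ, √(2*μ - (√(2*μ) * x)^2) = √(2*μ) * √(1 - x^2) := by
    intro x
    rw [← Real.sqrt_mul (by positivity), mul_pow, Real.sq_sqrt (by positivity)]
    congr 1; ring
  simp only [h2, intervalIntegral.integral_const_mul, integral_sqrt_one_sub_sq, mul_one, mul_neg,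
    smul_eq_mul] at h
  simp only [pow_zero, one_mul]
  have h3 : ∫ t in (-√(2*μ))..(√(2*μ)), √(2*μ - t^2) = 2*μ * (Real.pi/2) := by
    have := Real.mul_self_sqrt (show 0 ≤ 2*μ by positivity)
    nth_rewrite 4 [← this]
    rw [mul_assoc, h]
    field_simp
  rw [h3]
  have := Real.pi_pos
  field_simp

theorem smom_one (μ : ℝ) (hμ : 0 < μ) : smom μ 1 = 0 := by
  rw [smom_eq μ hμ]
  have h := intervalIntegral.integral_comp_neg (a := -√(2*μ)) (b := √(2*μ))
    (fun t => t^1 * √(2*μ - t^2))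
  simp only [neg_neg, pow_one, neg_sq, neg_mul, intervalIntegral.integral_neg] at h
  have : ∫ t in (-√(2*μ))..(√(2*μ)), t * √(2*μ - t^2) = 0 := by linarith
  simp only [pow_one]
  rw [this, mul_zero]

theorem smom_rec (μ : ℝ) (hμ : 0 < μ) (m : ℕ) :
    ((m:ℝ)+4) * smom μ (m+2) = (m+1) * (2*μ) * smom μ m := by
  have hR : 0 < √(2*μ) := Real.sqrt_pos.mpr (by positivity)
  have hR2 : √(2*μ) ^ 2 = 2*μ := Real.sq_sqrt (by positivity)
  have h := intervalIntegral.integral_eq_sub_of_hasDerivAt_of_le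
    (a := -√(2*μ)) (b := √(2*μ)) (by linarith)
    (f := fun t => t^(m+1) * ((2*μ - t^2) * √(2*μ - t^2)))
    (f' := fun t => (m+1) * (2*μ) * (t^m * √(2*μ - t^2)) - (m+4) * (t^(m+2) * √(2*μ - t^2)))
    (by fun_prop) ?_ (Continuous.intervalIntegrable (by fun_prop) _ _)
  · simp only [neg_sq, hR2, sub_self, zero_mul, mul_zero] at h
    rw [intervalIntegral.integral_sub (Continuous.intervalIntegrable (by fun_prop) _ _)
      (Continuous.intervalIntegrable (by fun_prop) _ _), intervalIntegral.integral_const_mul,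
      intervalIntegral.integral_const_mul] at h
    rw [smom_eq μ hμ, smom_eq μ hμ]
    linear_combination (-(1 / (Real.pi * μ))) * h
  · intro t ht
    have h2 : 0 < 2*μ - t^2 := by
      have : t^2 < √(2*μ)^2 := sq_lt_sq' ht.1 ht.2
      linarith
    have hw : HasDerivAt (fun t : ℝ => 2*μ - t^2) (-(2*t)) t := by
      simpa using (hasDerivAt_pow 2 t).const_sub (2*μ)
    have hsq := hw.sqrt h2.ne'
    have hp := hasDerivAt_pow (m+1) t
    have := hp.fun_mul (hw.fun_mul hsq)
    refine this.congr_deriv ?_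
    have hs : 0 < √(2*μ - t^2) := Real.sqrt_pos.mpr h2
    have hss : 2*μ - t^2 = √(2*μ - t^2) * √(2*μ - t^2) := (Real.mul_self_sqrt h2.le).symm
    have hd : (2*μ - t^2) * (-(2*t) / (2 * √(2*μ - t^2))) = - t * √(2*μ - t^2) := by
      nth_rewrite 1 [hss]
      field_simp
    rw [hd]
    push_cast
    ring

theorem smom_odd (μ : ℝ) (hμ : 0 < μ) (k : ℕ) : smom μ (2*k+1) = 0 := by
  induction k with
  | zero => exact smom_one μ hμ
  | succ k ih =>
    have := smom_rec μ hμ (2*k+1)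
    rw [ih, mul_zero] at this
    rcases mul_eq_zero.mp this with h | h
    · exact absurd h (by positivity)
    · exact h

theorem catalan_rec (k : ℕ) : ((k:ℝ)+2) * catalan (k+1) = 2*(2*k+1) * catalan k := by
  have h1 := succ_mul_catalan_eq_centralBinom k
  have h2 := succ_mul_catalan_eq_centralBinom (k+1)
  have h3 := Nat.succ_mul_centralBinom_succ k
  rw [← h1, ← h2] at h3
  have h4 : ((k:ℝ)+1) * (((k:ℝ)+1+1) * catalan (k+1)) = 2*(2*k+1)*(((k:ℝ)+1) * catalan k) := by
    exact_mod_cast h3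
  have : (k:ℝ)+1 ≠ 0 := by positivity
  refine mul_left_cancel₀ this ?_
  linear_combination h4

theorem smom_even (μ : ℝ) (hμ : 0 < μ) (k : ℕ) : smom μ (2*k) = (μ/2)^k * catalan k := by
  induction k with
  | zero => simp [smom_zero μ hμ]
  | succ k ih =>
    have h := smom_rec μ hμ (2*k)
    rw [ih] at h
    have hc := catalan_rec k
    have : 2*((k:ℝ)+2) ≠ 0 := by positivity
    refine mul_left_cancel₀ this ?_
    rw [show 2*(k+1) = 2*k+2 by ring]
    push_cast at h
    linear_combination h - 2 * (μ/2)^(k+1) * hc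

theorem sum_even (g : ℕ → ℝ) (hg : ∀ i, g (2*i+1) = 0) (k : ℕ) :
    ∑ i ∈ Finset.range (2*k+1), g i = ∑ i ∈ Finset.range (k+1), g (2*i) := by
  induction k with
  | zero => simp
  | succ k ih =>
    rw [show 2*(k+1)+1 = 2*k+1+1+1 by ring, Finset.sum_range_succ, Finset.sum_range_succ, ih, hg,
      Finset.sum_range_succ _ (k+1)]
    simp [mul_add]

theorem smom_conv (μ : ℝ) (hμ : 0 < μ) (m : ℕ) :
    smom μ (m+2) = μ/2 * ∑ i ∈ Finset.range (m+1), smom μ i * smom μ (m-i) := by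
  rcases Nat.even_or_odd' m with ⟨k, rfl | rfl⟩
  · rw [sum_even (fun i => smom μ i * smom μ (2*k-i)) (fun i => by simp [smom_odd μ hμ])]
    rw [show 2*k+2 = 2*(k+1) by ring, smom_even μ hμ, catalan_succ, Fin.sum_univ_eq_sum_range
      (fun i => catalan i * catalan (k-i)), pow_succ]
    push_cast
    rw [Finset.mul_sum, Finset.mul_sum]
    refine Finset.sum_congr rfl fun i hi => ?_
    have hi' : i ≤ k := by have := Finset.mem_range.mp hi; omega
    rw [← Nat.mul_sub, smom_even μ hμ, smom_even μ hμ]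
    have : (μ/2)^k = (μ/2)^i * (μ/2)^(k-i) := by rw [← pow_add]; congr 1; omega
    rw [this]; ring
  · rw [show 2*k+1+2 = 2*(k+1)+1 by ring, smom_odd μ hμ, Finset.sum_eq_zero, mul_zero]
    intro i hi
    have hi' := Finset.mem_range.mp hi
    rcases Nat.even_or_odd' i with ⟨l, rfl | rfl⟩
    · rw [show 2*k+1-2*l = 2*(k-l)+1 by omega, smom_odd μ hμ, mul_zero]
    · rw [smom_odd μ hμ, zero_mul]

theorem int_bound (μ : ℝ) (hμ : 0 < μ) (g : ℝ → ℝ) (hg : Continuous g) (c : ℝ)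
    (hc : ∀ t, |t| ≤ √(2*μ) → |g t| ≤ c) : |∫ t, g t * rhoSC μ t| ≤ c := by
  have hR : 0 ≤ √(2*μ) := Real.sqrt_nonneg _
  have h1 : ∫ t, 1 * rhoSC μ t = 1 := by
    have := smom_zero μ hμ
    simpa [smom] using this
  rw [rho_integral μ (fun _ => 1)] at h1
  have hρ := rho_cont μ
  rw [rho_integral]
  calc |∫ t in (-√(2*μ))..(√(2*μ)), g t * rhoSC μ t|
      ≤ ∫ t in (-√(2*μ))..(√(2*μ)), |g t * rhoSC μ t| :=
        intervalIntegral.abs_integral_le_integral_abs (by linarith)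
    _ ≤ ∫ t in (-√(2*μ))..(√(2*μ)), c * (1 * rhoSC μ t) := by
        refine intervalIntegral.integral_mono_on (by linarith)
          (Continuous.intervalIntegrable (by fun_prop) _ _)
          (Continuous.intervalIntegrable (by fun_prop) _ _) ?_
        intro t ht
        rw [abs_mul, abs_of_nonneg (rho_nonneg μ hμ t), one_mul]
        exact mul_le_mul_of_nonneg_right (hc t (abs_le.mpr ht)) (rho_nonneg μ hμ t)
    _ = c := by rw [intervalIntegral.integral_const_mul, h1, mul_one]

theorem smom_le (μ : ℝ) (hμ : 0 < μ) (m : ℕ) : smom μ m ≤ √(2*μ)^m := by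
  refine (le_abs_self _).trans (int_bound μ hμ (fun t => t^m) (by fun_prop) _ ?_)
  intro t ht
  rw [abs_pow]
  exact pow_le_pow_left₀ (abs_nonneg _) ht _

theorem rho_integrable (μ : ℝ) (g : ℝ → ℝ) (hg : Continuous g) :
    Integrable (fun t => g t * rhoSC μ t) := by
  have hρ := rho_cont μ
  refine Continuous.integrable_of_hasCompactSupport (by fun_prop) ?_
  refine HasCompactSupport.intro (K := Set.Icc (-√(2*μ)) (√(2*μ))) isCompact_Icc ?_
  intro t ht
  have : 2*μ - t^2 ≤ 0 := by
    by_contra hc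
    push Not at hc
    have := abs_lt.mp (Real.lt_sqrt_of_sq_lt (show |t|^2 < 2*μ by rw [sq_abs]; linarith))
    exact ht ⟨this.1.le, this.2.le⟩
  simp [rhoSC, max_eq_right this]

theorem moments_tendsto (μ : ℝ) (hμ : 0 < μ)
    (hbar : ℕ → ℝ) (hbar_pos : ∀ N, 0 < hbar N)
    (hbar_lim : Tendsto (fun N : ℕ => (N : ℝ) * hbar N) atTop (nhds μ))
    (y : (N : ℕ) → Fin N → ℝ)
    (hy_zero : ∀ N : ℕ, ∀ j : Fin N, hermiteH N (y N j / Real.sqrt (hbar N)) = 0)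
    (hy_inj : ∀ N : ℕ, Function.Injective (y N)) (m : ℕ) :
    Tendsto (fun N : ℕ => (1 / (N : ℝ)) * ∑ j : Fin N, y N j ^ m) atTop (nhds (smom μ m)) := by
  have hs : ∀ N j, y N j = hbar N * ∑ k, 1 / (y N j - y N k) := fun N j =>
    stieltjes_scaled N (hbar N) (hbar_pos N) (y N) (hy_zero N) (hy_inj N) j
  have hinv : Tendsto (fun N : ℕ => 1 / (N : ℝ)) atTop (nhds 0) :=
    tendsto_one_div_atTop_nhds_zero_nat
  have hb0 : Tendsto hbar atTop (nhds 0) := by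
    have := hinv.mul hbar_lim
    rw [zero_mul] at this
    refine this.congr' ?_
    filter_upwards [eventually_gt_atTop 0] with N hN
    have : (N : ℝ) ≠ 0 := by positivity
    field_simp
  induction m using Nat.strong_induction_on with
  | _ m ih =>
    match m, ih with
    | 0, _ =>
      rw [smom_zero μ hμ]
      refine tendsto_const_nhds.congr' ?_
      filter_upwards [eventually_gt_atTop 0] with N hN
      have : (N : ℝ) ≠ 0 := by positivity
      simp [this]
    | 1, _ =>
      rw [smom_one μ hμ]
      refine tendsto_const_nhds.congr fun N => ?_
      simp only [pow_one]
      rw [power_sum_one N (hbar N) (y N) (hs N), mul_zero]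
    | m+2, ih =>
      have h1 : Tendsto (fun N : ℕ => ∑ i ∈ Finset.range (m+1),
          ((1 / (N : ℝ)) * ∑ j : Fin N, y N j ^ i) * ((1 / (N : ℝ)) * ∑ j : Fin N, y N j ^ (m-i)))
          atTop (nhds (∑ i ∈ Finset.range (m+1), smom μ i * smom μ (m-i))) := by
        refine tendsto_finsetSum _ fun i hi => ?_
        have := Finset.mem_range.mp hi
        exact (ih i (by omega)).mul (ih (m-i) (by omega))
      have h2 := ((hbar_lim.div_const 2).mul h1).sub
        ((hb0.mul_const (((m:ℝ)+1)/2)).mul (ih m (by omega)))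
      rw [zero_mul, zero_mul, sub_zero, ← smom_conv μ hμ] at h2
      refine h2.congr' ?_
      filter_upwards [eventually_gt_atTop 0] with N hN
      have hN' : (N : ℝ) ≠ 0 := by positivity
      have hr := power_sum_rec N (hbar N) (y N) (hy_inj N) (hs N) m
      have h3 : ∑ i ∈ Finset.range (m+1),
          ((1 / (N : ℝ)) * ∑ j : Fin N, y N j ^ i) * ((1 / (N : ℝ)) * ∑ j : Fin N, y N j ^ (m-i))
          = (1 / (N:ℝ))^2 * ∑ i ∈ Finset.range (m+1),
          (∑ j : Fin N, y N j ^ i) * (∑ j : Fin N, y N j ^ (m-i)) := by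
        rw [Finset.mul_sum]
        exact Finset.sum_congr rfl fun i _ => by ring
      rw [h3]
      have h4 : ∑ j, y N j ^ (m+2) = hbar N * (∑ i ∈ Finset.range (m+1),
          (∑ j, y N j ^ i) * (∑ j, y N j ^ (m - i)) - (m+1) * ∑ j, y N j ^ m) / 2 := by
        rw [← hr]; ring
      rw [h4]
      field_simp

/-- A polynomial grows slower than a large even power. -/
theorem poly_growth (p : Polynomial ℝ) (t : ℝ) (ht : 1 ≤ |t|) :
    |p.eval t| ≤ (∑ i ∈ Finset.range (p.natDegree+1), |p.coeff i|) * |t|^p.natDegree := by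
  rw [Polynomial.eval_eq_sum_range, Finset.sum_mul]
  refine (Finset.abs_sum_le_sum_abs _ _).trans (Finset.sum_le_sum fun i hi => ?_)
  rw [abs_mul, abs_pow]
  have := Finset.mem_range.mp hi
  exact mul_le_mul_of_nonneg_left (pow_le_pow_right₀ ht (by omega)) (abs_nonneg _)

theorem poly_tendsto (μ : ℝ) (y : (N : ℕ) → Fin N → ℝ)
    (hm : ∀ m : ℕ, Tendsto (fun N : ℕ => (1 / (N : ℝ)) * ∑ j : Fin N, y N j ^ m) atTop
      (nhds (smom μ m))) (p : Polynomial ℝ) :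
    Tendsto (fun N : ℕ => (1 / (N : ℝ)) * ∑ j : Fin N, p.eval (y N j)) atTop
      (nhds (∫ t, p.eval t * rhoSC μ t)) := by
  have h1 : ∫ t, p.eval t * rhoSC μ t
      = ∑ i ∈ Finset.range (p.natDegree+1), p.coeff i * smom μ i := by
    simp only [Polynomial.eval_eq_sum_range, Finset.sum_mul]
    rw [integral_finsetSum]
    · refine Finset.sum_congr rfl fun i _ => ?_
      rw [smom, ← integral_const_mul]
      simp only [mul_assoc]
    · intro i _
      exact rho_integrable μ (fun t => p.coeff i * t^i) (by fun_prop)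
  rw [h1]
  have h2 : Tendsto (fun N : ℕ => ∑ i ∈ Finset.range (p.natDegree+1),
      p.coeff i * ((1 / (N : ℝ)) * ∑ j : Fin N, y N j ^ i)) atTop
      (nhds (∑ i ∈ Finset.range (p.natDegree+1), p.coeff i * smom μ i)) :=
    tendsto_finsetSum _ fun i _ => (hm i).const_mul _
  refine h2.congr fun N => ?_
  simp only [Polynomial.eval_eq_sum_range]
  rw [Finset.sum_comm, Finset.mul_sum]
  refine Finset.sum_congr rfl fun i _ => ?_
  rw [← Finset.mul_sum]
  ring

theorem weak_of_moments (μ : ℝ) (hμ : 0 < μ) (y : (N : ℕ) → Fin N → ℝ)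
    (hm : ∀ m : ℕ, Tendsto (fun N : ℕ => (1 / (N : ℝ)) * ∑ j : Fin N, y N j ^ m) atTop
      (nhds (smom μ m)))
    (f : ℝ → ℝ) (hf : Continuous f) (M : ℝ) (hM : ∀ t, |f t| ≤ M) :
    Tendsto (fun N : ℕ => (1 / (N : ℝ)) * ∑ j : Fin N, f (y N j))
      atTop (nhds (∫ t : ℝ, f t * rhoSC μ t)) := by
  have hM0 : 0 ≤ M := (abs_nonneg _).trans (hM 0)
  set R := √(2*μ) with hR
  have hR0 : 0 ≤ R := Real.sqrt_nonneg _
  set K := R + 1 with hK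
  have hK1 : 1 ≤ K := by linarith
  have hK0 : 0 < K := by linarith
  rw [Metric.tendsto_atTop']
  intro ε hε
  obtain ⟨p, hp⟩ := exists_polynomial_near_of_continuousOn (-K) K f hf.continuousOn (ε/5)
    (by positivity)
  set A := ∑ i ∈ Finset.range (p.natDegree+1), |p.coeff i| with hA
  have hA0 : 0 ≤ A := Finset.sum_nonneg fun _ _ => abs_nonneg _
  set B := M + A * K^p.natDegree with hB
  have hB0 : 0 ≤ B := by positivity
  -- pointwise bound
  have hpt : ∀ d, p.natDegree ≤ 2*d → ∀ t, |p.eval t - f t| ≤ ε/5 + B * (t/K)^(2*d) := by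
    intro d hd t
    have hpow : 0 ≤ (t/K)^(2*d) := by rw [pow_mul]; positivity
    by_cases ht : |t| ≤ K
    · have := hp t (abs_le.mp ht)
      have := mul_nonneg hB0 hpow
      linarith
    · push Not at ht
      have hu : 1 ≤ |t|/K := by rw [le_div_iff₀ hK0]; linarith
      have h1 := poly_growth p t (by linarith)
      have h2 : |t|^p.natDegree = K^p.natDegree * (|t|/K)^p.natDegree := by
        rw [← mul_pow]; congr 1; field_simp
      have h3 : (|t|/K)^p.natDegree ≤ (|t|/K)^(2*d) := pow_le_pow_right₀ hu hd
      have h4 : (|t|/K)^(2*d) = (t/K)^(2*d) := by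
        rw [pow_mul, pow_mul, div_pow |t|, sq_abs, ← div_pow t]
      have h5 : 1 ≤ (t/K)^(2*d) := by rw [← h4]; exact one_le_pow₀ hu
      have h6 : |p.eval t| ≤ A * K^p.natDegree * (t/K)^(2*d) := by
        refine h1.trans ?_
        rw [h2, ← mul_assoc, ← h4]
        exact mul_le_mul_of_nonneg_left h3 (by positivity)
      have h7 : M ≤ M * (t/K)^(2*d) := le_mul_of_one_le_right hM0 h5
      have h8 := abs_sub (p.eval t) (f t)
      have h9 := hM t
      rw [hB, add_mul]
      linarith
  -- choose the degree
  have hlt : R/K < 1 := by rw [div_lt_one hK0]; linarith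
  have hgeo : Tendsto (fun d : ℕ => B * ((R/K)^2)^d) atTop (nhds (B * 0)) :=
    (tendsto_pow_atTop_nhds_zero_of_lt_one (by positivity)
      (pow_lt_one₀ (by positivity) hlt (by norm_num))).const_mul B
  rw [mul_zero] at hgeo
  obtain ⟨d, hd1, hd2⟩ := ((hgeo.eventually (gt_mem_nhds (show 0 < ε/5 by positivity))).and
    (eventually_ge_atTop p.natDegree)).exists
  have hd := hpt d (by omega)
  -- tail limit
  have htail : Tendsto (fun N : ℕ => B / K^(2*d) * ((1 / (N : ℝ)) * ∑ j : Fin N, y N j ^ (2*d)))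
      atTop (nhds (B / K^(2*d) * smom μ (2*d))) := (hm (2*d)).const_mul _
  have hlim : B / K^(2*d) * smom μ (2*d) < ε/5 := by
    refine lt_of_le_of_lt ?_ hd1
    have := smom_le μ hμ (2*d)
    rw [← pow_mul, div_pow, mul_div_assoc', div_mul_eq_mul_div]
    gcongr
  have hint : |∫ t, (p.eval t - f t) * rhoSC μ t| ≤ ε/5 := by
    refine int_bound μ hμ (fun t => p.eval t - f t) (by fun_prop) _ fun t ht => ?_
    exact (hp t (abs_le.mp (by linarith))).le
  have hint2 : ∫ t, (p.eval t - f t) * rhoSC μ t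
      = (∫ t, p.eval t * rhoSC μ t) - ∫ t, f t * rhoSC μ t := by
    rw [← integral_sub (rho_integrable μ (fun t => p.eval t) (by fun_prop))
      (rho_integrable μ f hf)]
    simp only [sub_mul]
  have hpoly := (Metric.tendsto_nhds.mp (poly_tendsto μ y hm p)) (ε/5) (by positivity)
  have hev : ∀ᶠ N : ℕ in atTop, dist ((1 / (N : ℝ)) * ∑ j : Fin N, f (y N j))
      (∫ t : ℝ, f t * rhoSC μ t) < ε := by
    filter_upwards [hpoly, htail.eventually (gt_mem_nhds hlim), eventually_gt_atTop 0]
      with N h1 h2 hN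
    have hN' : (0 : ℝ) < N := by exact_mod_cast hN
    rw [Real.dist_eq] at h1 ⊢
    have h3 : |(1 / (N : ℝ)) * ∑ j : Fin N, p.eval (y N j)
        - (1 / (N : ℝ)) * ∑ j : Fin N, f (y N j)|
        ≤ ε/5 + B / K^(2*d) * ((1 / (N : ℝ)) * ∑ j : Fin N, y N j ^ (2*d)) := by
      rw [← mul_sub, ← Finset.sum_sub_distrib, abs_mul, abs_of_pos (by positivity)]
      have h4 : |∑ j : Fin N, (p.eval (y N j) - f (y N j))|
          ≤ ∑ j : Fin N, (ε/5 + B / K^(2*d) * y N j ^ (2*d)) := by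
        refine (Finset.abs_sum_le_sum_abs _ _).trans (Finset.sum_le_sum fun j _ => ?_)
        refine (hd (y N j)).trans (le_of_eq ?_)
        rw [div_pow]; ring
      refine (mul_le_mul_of_nonneg_left h4 (by positivity)).trans (le_of_eq ?_)
      rw [Finset.sum_add_distrib, ← Finset.mul_sum]
      simp only [Finset.sum_const, Finset.card_univ, Fintype.card_fin, nsmul_eq_mul]
      field_simp
    rw [hint2] at hint
    rw [abs_lt] at h1 ⊢
    rw [abs_le] at h3 hint
    constructor <;> linarith [h1.1, h1.2, h3.1, h3.2, hint.1, hint.2]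
  obtain ⟨n, hn⟩ := eventually_atTop.mp hev
  exact ⟨n, fun N hN => hn N hN.le⟩

/-- The empirical measure of the eigenvalues of the Zeno Hamiltonian `H_N`
(i.e. of the `N` zeros of `y ↦ h_N(y/√ℏ_N)`) converges weakly to the
semicircular density `ρ_μ` when `N·ℏ_N → μ > 0`. -/
theorem eigenvalue_counting_semicircle (μ : ℝ) (hμ : 0 < μ)
    (hbar : ℕ → ℝ) (hbar_pos : ∀ N, 0 < hbar N)
    (hbar_lim : Tendsto (fun N : ℕ => (N : ℝ) * hbar N) atTop (nhds μ))
    (y : (N : ℕ) → Fin N → ℝ)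
    (hy_zero : ∀ N : ℕ, ∀ j : Fin N, hermiteH N (y N j / Real.sqrt (hbar N)) = 0)
    (hy_inj : ∀ N : ℕ, Function.Injective (y N))
    (f : ℝ → ℝ) (hf_cont : Continuous f) (hf_bdd : ∃ M : ℝ, ∀ t : ℝ, |f t| ≤ M) :
    Tendsto (fun N : ℕ => (1 / (N : ℝ)) * ∑ j : Fin N, f (y N j))
      atTop (nhds (∫ t : ℝ, f t * rhoSC μ t)) := by
  obtain ⟨M, hM⟩ := hf_bdd
  exact weak_of_moments μ hμ y
    (moments_tendsto μ hμ hbar hbar_pos hbar_lim y hy_zero hy_inj) f hf_cont M hM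
end

section
/- Fix ℏ > 0 and an integer N ≥ 1. For all u, v ∈ ℝ, −iℏ (∂K_N/∂u)(u,v) − Q_N(u,v) = i√(ℏN/2) ψ_N^ℏ(u) ψ_{N−1}^ℏ(v); that is, the integral kernel of the operator [p̂, P_{<N}] P_{<N} = p̂ P_{<N} − P_{<N} p̂ P_{<N} is R_N(u,v) = i√(ℏN/2) ψ_N^ℏ(u) ψ_{N−1}^ℏ(v). -/
open MeasureTheory Filter

/-- Hermite function `ψ_k^ℏ`. -/
noncomputable def psiH (hbar : ℝ) (k : ℕ) (x : ℝ) : ℝ :=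
  (Real.sqrt (Real.sqrt Real.pi * 2^k * (Nat.factorial k) * Real.sqrt hbar))⁻¹ *
    Real.exp (-x^2 / (2*hbar)) * hermiteH k (x / Real.sqrt hbar)

/-- Kernel of the spectral projection `P_{<N}`. -/
noncomputable def KerK (hbar : ℝ) (N : ℕ) (u v : ℝ) : ℝ :=
  ∑ k ∈ Finset.range N, psiH hbar k u * psiH hbar k v

/-- Kernel of the Zeno Hamiltonian `H_N = P_{<N} p̂ P_{<N}`. -/
noncomputable def KerQ (hbar : ℝ) (N : ℕ) (u v : ℝ) : ℂ :=
  Complex.I * (Real.sqrt (hbar/2) : ℂ) *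
    ∑ j ∈ Finset.range (N-1), ((Real.sqrt ((j:ℝ)+1) : ℝ) : ℂ) *
      ((psiH hbar (j+1) u * psiH hbar j v - psiH hbar j u * psiH hbar (j+1) v : ℝ) : ℂ)

/-- Weyl symbol of `P_{<N}`. -/
noncomputable def sigmaP (hbar : ℝ) (N : ℕ) (x p : ℝ) : ℂ :=
  ∫ y : ℝ, ((hbar * KerK hbar N (x - hbar*y/2) (x + hbar*y/2) : ℝ) : ℂ) *
    Complex.exp (Complex.I * (p:ℂ) * (y:ℂ))

/-- Weyl symbol of `H_N`. -/
noncomputable def sigmaH (hbar : ℝ) (N : ℕ) (x p : ℝ) : ℂ :=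
  ∫ y : ℝ, (hbar : ℂ) * KerQ hbar N (x - hbar*y/2) (x + hbar*y/2) *
    Complex.exp (Complex.I * (p:ℂ) * (y:ℂ))


lemma gauss_hasDerivAt (k : ℕ) (y : ℝ) :
    HasDerivAt (iteratedDeriv k (fun t : ℝ => Real.exp (-t^2)))
      (iteratedDeriv (k+1) (fun t : ℝ => Real.exp (-t^2)) y) y := by
  rw [iteratedDeriv_succ]
  apply DifferentiableAt.hasDerivAt
  have h : ContDiff ℝ (k+1 : ℕ) (fun t : ℝ => Real.exp (-t^2)) := by fun_prop
  exact (h.differentiable_iteratedDeriv k (by exact_mod_cast Nat.lt_succ_self k)) y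

lemma gauss_rec (k : ℕ) : ∀ y : ℝ,
    iteratedDeriv (k+1) (fun t : ℝ => Real.exp (-t^2)) y =
      -2 * y * iteratedDeriv k (fun t : ℝ => Real.exp (-t^2)) y
      - 2 * k * iteratedDeriv (k-1) (fun t : ℝ => Real.exp (-t^2)) y := by
  induction k with
  | zero =>
    intro y
    have h1 : HasDerivAt (fun t : ℝ => Real.exp (-t^2)) (Real.exp (-y^2) * (-(2*y))) y := by
      have := ((hasDerivAt_pow 2 y).neg).exp
      simpa using this
    rw [zero_add, iteratedDeriv_one, h1.deriv]
    simp
    ring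
  | succ k ih =>
    intro y
    have h1 := gauss_hasDerivAt (k+1) y
    have h2 : HasDerivAt (iteratedDeriv (k+1) (fun t : ℝ => Real.exp (-t^2)))
        ((-2 * iteratedDeriv k (fun t : ℝ => Real.exp (-t^2)) y
          + -2 * y * iteratedDeriv (k+1) (fun t : ℝ => Real.exp (-t^2)) y)
          - 2 * k * iteratedDeriv k (fun t : ℝ => Real.exp (-t^2)) y) y := by
      have h0 : HasDerivAt (fun z : ℝ => -2 * z) (-2) y := by
        simpa using (hasDerivAt_id y).const_mul (-2 : ℝ)
      have ha := h0.mul (gauss_hasDerivAt k y)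
      have hb : HasDerivAt (fun z : ℝ => 2 * (k:ℝ) *
          iteratedDeriv (k-1) (fun t : ℝ => Real.exp (-t^2)) z)
          (2 * (k:ℝ) * iteratedDeriv k (fun t : ℝ => Real.exp (-t^2)) y) y := by
        rcases k with _ | m
        · simpa using hasDerivAt_const y (0:ℝ)
        · exact (gauss_hasDerivAt m y).const_mul _
      exact (ha.sub hb).congr_of_eventuallyEq (Filter.Eventually.of_forall ih)
    rw [h1.unique h2]
    push_cast [Nat.add_sub_cancel]
    ring

lemma hermiteH_hasDerivAt (k : ℕ) (y : ℝ) :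
    HasDerivAt (hermiteH k) (2 * y * hermiteH k y - hermiteH (k+1) y) y := by
  have h1 : HasDerivAt (fun t : ℝ => (-1)^k * Real.exp (t^2))
      ((-1)^k * (Real.exp (y^2) * (2*y))) y := by
    have := ((hasDerivAt_pow 2 y).exp).const_mul ((-1:ℝ)^k)
    simpa using this
  have h2 := h1.mul (gauss_hasDerivAt k y)
  refine HasDerivAt.congr_deriv (f := hermiteH k) h2 ?_
  simp only [hermiteH, pow_succ]
  ring

lemma hermiteH_rec (k : ℕ) (y : ℝ) :
    hermiteH (k+1) y = 2 * y * hermiteH k y - 2 * k * hermiteH (k-1) y := by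
  simp only [hermiteH, gauss_rec k y]
  rcases k with _ | m
  · simp; ring
  · simp only [pow_succ, Nat.add_sub_cancel]
    push_cast
    ring

/-- normalization constant -/
noncomputable def cH (hbar : ℝ) (k : ℕ) : ℝ :=
  (Real.sqrt (Real.sqrt Real.pi * 2^k * (Nat.factorial k) * Real.sqrt hbar))⁻¹

lemma cH_succ (hbar : ℝ) (k : ℕ) :
    cH hbar k = Real.sqrt 2 * Real.sqrt ((k:ℝ)+1) * cH hbar (k+1) := by
  have e : Real.sqrt Real.pi * 2^(k+1) * (Nat.factorial (k+1) : ℝ) * Real.sqrt hbar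
      = 2 * (((k:ℝ)+1) * (Real.sqrt Real.pi * 2^k * (Nat.factorial k) * Real.sqrt hbar)) := by
    rw [Nat.factorial_succ]; push_cast; ring
  have hk : (0:ℝ) < (k:ℝ)+1 := by positivity
  have h1 : Real.sqrt ((k:ℝ)+1) ≠ 0 := (Real.sqrt_pos.2 hk).ne'
  have h2 : Real.sqrt (2:ℝ) ≠ 0 := by positivity
  unfold cH
  rw [e, Real.sqrt_mul (by norm_num : (0:ℝ) ≤ 2), Real.sqrt_mul hk.le, mul_inv, mul_inv]
  field_simp

lemma psiH_hasDerivAt (hbar : ℝ) (hh : 0 < hbar) (k : ℕ) (x : ℝ) :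
    HasDerivAt (psiH hbar k) (-(Real.sqrt (hbar/2) / hbar) *
      (Real.sqrt ((k:ℝ)+1) * psiH hbar (k+1) x - Real.sqrt k * psiH hbar (k-1) x)) x := by
  have h1 : HasDerivAt (fun t : ℝ => cH hbar k * Real.exp (-t^2 / (2*hbar)))
      (cH hbar k * (Real.exp (-x^2/(2*hbar)) * (-(2*x)/(2*hbar)))) x := by
    have := ((((hasDerivAt_pow 2 x).neg).div_const (2*hbar)).exp).const_mul (cH hbar k)
    simpa using this
  have h2 : HasDerivAt (fun t : ℝ => hermiteH k (t / Real.sqrt hbar))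
      ((2 * (x / Real.sqrt hbar) * hermiteH k (x / Real.sqrt hbar)
        - hermiteH (k+1) (x / Real.sqrt hbar)) * (1 / Real.sqrt hbar)) x :=
    HasDerivAt.comp (h₂ := hermiteH k) (h := fun t : ℝ => t / Real.sqrt hbar) x
      (hermiteH_hasDerivAt k (x / Real.sqrt hbar))
      ((hasDerivAt_id x).div_const (Real.sqrt hbar))
  refine HasDerivAt.congr_deriv (f := psiH hbar k) (h1.mul h2) ?_
  have hp : ∀ j, psiH hbar j x = cH hbar j * Real.exp (-x^2 / (2*hbar)) *
    hermiteH j (x / Real.sqrt hbar) := fun j => rfl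
  rw [hp, hp]
  obtain ⟨s, hs, hs2⟩ : ∃ s : ℝ, 0 < s ∧ hbar = s^2 :=
    ⟨Real.sqrt hbar, Real.sqrt_pos.2 hh, (Real.sq_sqrt hh.le).symm⟩
  have hss : Real.sqrt hbar = s := by rw [hs2, Real.sqrt_sq hs.le]
  have hsd : Real.sqrt (hbar/2) = s / Real.sqrt 2 := by
    rw [Real.sqrt_div hh.le, hss]
  rw [hsd, hss]
  have hw : Real.sqrt 2 ^ 2 = (2:ℝ) := Real.sq_sqrt (by norm_num)
  have hw0 : Real.sqrt (2:ℝ) ≠ 0 := by positivity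
  have hA : Real.sqrt ((k:ℝ)+1) * cH hbar (k+1) = cH hbar k / Real.sqrt 2 := by
    rw [cH_succ hbar k]; field_simp
  have hB : Real.sqrt k * cH hbar (k-1) = cH hbar k * (k * Real.sqrt 2) := by
    rcases k with _ | m
    · simp
    · simp only [Nat.add_sub_cancel]
      rw [cH_succ hbar m]
      have : Real.sqrt ((m:ℝ)+1) ^ 2 = (m:ℝ)+1 := Real.sq_sqrt (by positivity)
      push_cast
      linear_combination (Real.sqrt 2 * cH hbar (m+1)) * this
  have hr := hermiteH_rec k (x / s)
  generalize Real.exp (-x^2 / (2*hbar)) = E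
  have e : Real.sqrt ((k:ℝ)+1) * (cH hbar (k+1) * E * hermiteH (k+1) (x/s))
      - Real.sqrt k * (cH hbar (k-1) * E * hermiteH (k-1) (x/s))
      = cH hbar k * E * (hermiteH (k+1) (x/s) / Real.sqrt 2
          - k * Real.sqrt 2 * hermiteH (k-1) (x/s)) := by
    linear_combination (E * hermiteH (k+1) (x/s)) * hA - (E * hermiteH (k-1) (x/s)) * hB
  rw [e, hr]
  generalize cH hbar k = c
  subst hs2
  generalize hermiteH k (x/s) = H0
  generalize hermiteH (k-1) (x/s) = H1
  generalize Real.sqrt 2 = w at *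
  field_simp
  rw [hw]
  ring

lemma sum_ladder (hbar : ℝ) (n : ℕ) (u v : ℝ) :
    ∑ k ∈ Finset.range (n+1), (Real.sqrt ((k:ℝ)+1) * psiH hbar (k+1) u
        - Real.sqrt k * psiH hbar (k-1) u) * psiH hbar k v
      = ∑ j ∈ Finset.range n, Real.sqrt ((j:ℝ)+1) *
          (psiH hbar (j+1) u * psiH hbar j v - psiH hbar j u * psiH hbar (j+1) v)
        + Real.sqrt ((n:ℝ)+1) * (psiH hbar (n+1) u * psiH hbar n v) := by
  induction n with
  | zero => simp
  | succ n ih =>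
    rw [Finset.sum_range_succ, ih, Finset.sum_range_succ _ n]
    push_cast [Nat.add_sub_cancel]
    ring

/-- The integral kernel of the commutator term `[p̂, P_{<N}] P_{<N} = p̂ P_{<N} - P_{<N} p̂ P_{<N}`
is `R_N(u,v) = i√(ℏN/2) ψ_N^ℏ(u) ψ_{N-1}^ℏ(v)`. -/
theorem kernel_of_commutator (hbar : ℝ) (hh : 0 < hbar) (N : ℕ) (hN : 1 ≤ N) (u v : ℝ) :
    -(Complex.I * (hbar : ℂ)) * ((deriv (fun u' => KerK hbar N u' v) u : ℝ) : ℂ)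
        - KerQ hbar N u v
      = Complex.I * (Real.sqrt (hbar * N / 2) : ℂ) *
          ((psiH hbar N u : ℝ) : ℂ) * ((psiH hbar (N-1) v : ℝ) : ℂ) := by
  obtain ⟨n, rfl⟩ : ∃ n, N = n + 1 := ⟨N - 1, by omega⟩
  have hd : HasDerivAt (fun u' => KerK hbar (n+1) u' v)
      (∑ k ∈ Finset.range (n+1), (-(Real.sqrt (hbar/2) / hbar) *
        (Real.sqrt ((k:ℝ)+1) * psiH hbar (k+1) u - Real.sqrt k * psiH hbar (k-1) u))
          * psiH hbar k v) u := by
    unfold KerK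
    exact HasDerivAt.fun_sum fun k _ => (psiH_hasDerivAt hbar hh k u).mul_const _
  have hs : hbar * deriv (fun u' => KerK hbar (n+1) u' v) u =
      -Real.sqrt (hbar/2) * (∑ j ∈ Finset.range n, Real.sqrt ((j:ℝ)+1) *
          (psiH hbar (j+1) u * psiH hbar j v - psiH hbar j u * psiH hbar (j+1) v)
        + Real.sqrt ((n:ℝ)+1) * (psiH hbar (n+1) u * psiH hbar n v)) := by
    rw [hd.deriv, ← sum_ladder, Finset.mul_sum, Finset.mul_sum]
    refine Finset.sum_congr rfl fun k _ => ?_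
    field_simp
  have hq : Real.sqrt (hbar * ((n+1 : ℕ) : ℝ) / 2)
      = Real.sqrt (hbar/2) * Real.sqrt ((n:ℝ)+1) := by
    rw [← Real.sqrt_mul (by positivity)]
    congr 1
    push_cast
    ring
  have hs' := congrArg (fun r : ℝ => (r : ℂ)) hs
  rw [hq]
  unfold KerQ
  simp only [Nat.add_sub_cancel]
  push_cast at hs' ⊢
  linear_combination (-Complex.I) * hs'
end

section
/- (Groenewold's formula.) Fix ℏ > 0 and integers 0 ≤ j ≤ k. For all x, p ∈ ℝ, ∫_ℝ ℏ ψ_j^ℏ(x − ℏy/2) ψ_k^ℏ(x + ℏy/2) e^{ipy} dy = 2 √((2/ℏ)^{k−j} · j!/k!) · (x + ip)^{k−j} · e^{−(p²+x²)/ℏ} · (−1)^j L_j^{(k−j)}(2(p²+x²)/ℏ). -/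
open MeasureTheory Filter

/-- Associated Laguerre polynomial
`L_k^{(j)}(y) = Σ_{m=0}^k ((k+j)!/((k-m)!(j+m)!m!)) (-y)^m`. -/
noncomputable def laguerreL (j k : ℕ) (y : ℝ) : ℝ :=
  ∑ m ∈ Finset.range (k+1),
    ((Nat.factorial (k+j) : ℝ) /
      ((Nat.factorial (k-m) : ℝ) * (Nat.factorial (j+m) : ℝ) * (Nat.factorial m : ℝ))) * (-y)^m


namespace Groen
open Polynomial

/-- Hermite polynomials by recursion, over `ℂ`. -/
noncomputable def Hp : ℕ → ℂ[X]
  | 0 => 1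
  | (n+1) => 2 * X * Hp n - derivative (Hp n)

lemma Hp_succ (n : ℕ) : Hp (n+1) = 2 * X * Hp n - derivative (Hp n) := rfl

lemma Hp_deriv (n : ℕ) : derivative (Hp (n+1)) = 2 * ((n:ℂ[X])+1) * Hp n := by
  induction n with
  | zero => simp [Hp]
  | succ n ih =>
    rw [Hp_succ (n+1), derivative_sub, derivative_mul, ih]
    have h2 : derivative (2 * ((n:ℂ[X])+1) * Hp n) = 2 * ((n:ℂ[X])+1) * derivative (Hp n) := by
      simp [derivative_mul]
    rw [h2]
    simp only [derivative_mul, derivative_X, derivative_ofNat]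
    rw [Hp_succ n]
    push_cast
    ring

lemma Hp_deriv' (n : ℕ) : derivative (Hp n) = 2 * (n:ℂ[X]) * Hp (n-1) := by
  cases n with
  | zero => simp [Hp]
  | succ n => rw [Hp_deriv]; simp

lemma iter_eq (k : ℕ) (t : ℝ) :
    ((iteratedDeriv k (fun t : ℝ => Real.exp (-t^2)) t : ℝ) : ℂ)
      = (-1)^k * (Hp k).eval (t:ℂ) * Complex.exp (-(t:ℂ)^2) := by
  induction k generalizing t with
  | zero => simp [Hp]
  | succ k ih =>
    rw [iteratedDeriv_succ]
    have hcd : ContDiff ℝ (⊤ : ℕ∞) (fun t : ℝ => Real.exp (-t^2)) := by fun_prop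
    have hd : DifferentiableAt ℝ (iteratedDeriv k (fun t : ℝ => Real.exp (-t^2))) t :=
      (hcd.differentiable_iteratedDeriv k (by exact_mod_cast WithTop.coe_lt_top _)) t
    have h1 := hd.hasDerivAt.ofReal_comp
    have h2 : HasDerivAt (fun t : ℝ => (-1:ℂ)^k * (Hp k).eval (t:ℂ) * Complex.exp (-(t:ℂ)^2))
      ((-1:ℂ)^(k+1) * (Hp (k+1)).eval (t:ℂ) * Complex.exp (-(t:ℂ)^2)) t := by
      have ha : HasDerivAt (fun z : ℂ => (-1:ℂ)^k * (Hp k).eval z * Complex.exp (-z^2))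
        ((-1:ℂ)^(k+1) * (Hp (k+1)).eval (t:ℂ) * Complex.exp (-(t:ℂ)^2)) (t:ℂ) := by
        have := (((Hp k).hasDerivAt (t:ℂ)).const_mul ((-1:ℂ)^k)).mul
          (((hasDerivAt_id (t:ℂ)).pow 2).neg.cexp)
        refine this.congr_deriv ?_
        rw [Hp_succ]
        simp
        ring
      exact ha.comp_ofReal
    have h3 : (fun y : ℝ => ((iteratedDeriv k (fun t : ℝ => Real.exp (-t^2)) y : ℝ) : ℂ)) =
      (fun t : ℝ => (-1:ℂ)^k * (Hp k).eval (t:ℂ) * Complex.exp (-(t:ℂ)^2)) := funext ih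
    rw [h3] at h1
    exact h1.unique h2

lemma hermiteH_eq (k : ℕ) (y : ℝ) : ((hermiteH k y : ℝ) : ℂ) = (Hp k).eval (y:ℂ) := by
  unfold hermiteH
  push_cast
  rw [iter_eq]
  have h1 : ((-1:ℂ)^k) * (-1)^k = 1 := by rw [← mul_pow]; simp
  have h2 : Complex.exp ((y:ℂ)^2) * Complex.exp (-(y:ℂ)^2) = 1 := by
    rw [← Complex.exp_add]; simp
  linear_combination (Hp k).eval (y:ℂ) * Complex.exp ((y:ℂ)^2) * Complex.exp (-(y:ℂ)^2) * h1
    + (Hp k).eval (y:ℂ) * h2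

/-- Gaussian weight. -/
noncomputable def W (q : ℝ) (s : ℝ) : ℂ := Complex.exp (-(s:ℂ)^2 + 2 * Complex.I * q * s)

lemma integ (q : ℝ) (P : ℂ[X]) : Integrable (fun s : ℝ => P.eval (s:ℂ) * W q s) := by
  induction P using Polynomial.induction_on' with
  | add P Q hP hQ =>
    refine (hP.add hQ).congr (Filter.Eventually.of_forall fun s => ?_)
    simp [add_mul]
  | monomial n a =>
    have h := (integrable_rpow_mul_exp_neg_mul_sq (b := 1) one_pos
      (s := (n:ℝ)) (by have : (0:ℝ) ≤ n := n.cast_nonneg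
                       linarith)).norm.const_mul ‖a‖
    refine h.mono ?_ ?_
    · refine Continuous.aestronglyMeasurable ?_
      unfold W
      simp only [eval_monomial]
      fun_prop
    · refine Filter.Eventually.of_forall fun s => ?_
      simp only [W, eval_monomial, norm_mul, Complex.norm_exp, Real.rpow_natCast, norm_pow]
      simp [← Complex.ofReal_pow]
      rw [mul_assoc]

/-- The Gaussian functional on polynomials. -/
noncomputable def J (q : ℝ) (P : ℂ[X]) : ℂ := ∫ s : ℝ, P.eval (s:ℂ) * W q s

lemma J_add (q : ℝ) (P Q : ℂ[X]) : J q (P + Q) = J q P + J q Q := by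
  unfold J
  rw [← integral_add (integ q P) (integ q Q)]
  simp [add_mul]

lemma J_C (q : ℝ) (a : ℂ) (P : ℂ[X]) : J q (C a * P) = a * J q P := by
  unfold J
  rw [← integral_const_mul]
  simp [mul_assoc]

lemma J_deriv (q : ℝ) (P : ℂ[X]) :
    J q (derivative P + (C (2*Complex.I*q) - 2 * X) * P) = 0 := by
  unfold J
  refine integral_eq_zero_of_hasDerivAt_of_integrable (f := fun s : ℝ => P.eval (s:ℂ) * W q s)
    ?_ (integ q _) (integ q _)
  intro s
  have ha : HasDerivAt (fun z : ℂ => P.eval z * Complex.exp (-z^2 + 2*Complex.I*q*z))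
        ((derivative P + (C (2*Complex.I*q) - 2 * X) * P).eval (s:ℂ) * W q s) (s:ℂ) := by
    have := (P.hasDerivAt (s:ℂ)).mul
          (((((hasDerivAt_id (s:ℂ)).pow 2).neg).add
            ((hasDerivAt_id (s:ℂ)).const_mul (2*Complex.I*q))).cexp)
    refine this.congr_deriv ?_
    simp [W]
    ring
  exact ha.comp_ofReal

lemma J_one (q : ℝ) : J q 1 = (Real.sqrt Real.pi : ℂ) * Complex.exp (-(q:ℂ)^2) := by
  have h := fourierIntegral_gaussian (b := 1) (by simp) (2*q : ℂ)
  unfold J W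
  have e : ∀ s : ℝ, (1:ℂ[X]).eval (s:ℂ) * Complex.exp (-(s:ℂ)^2 + 2 * Complex.I * q * s) =
    Complex.exp (Complex.I * (2*q) * s) * Complex.exp (-1 * (s:ℂ)^2) := by
    intro s
    rw [eval_one, one_mul, ← Complex.exp_add]
    congr 1; ring
  simp_rw [e]
  rw [h, Real.sqrt_eq_rpow, Complex.ofReal_cpow Real.pi_pos.le]
  push_cast
  congr 2
  · simp
  · ring

/-- The product polynomial. -/
noncomputable def PP (u : ℝ) (j k : ℕ) : ℂ[X] := (Hp j).comp (C (u:ℂ) - X) * (Hp k).comp (C (u:ℂ) + X)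

lemma rec1 (u q : ℝ) (j k : ℕ) :
    J q (PP u j (k+1)) = 2*(u + Complex.I*q) * J q (PP u j k) - 2*j * J q (PP u (j-1) k) := by
  have h := J_deriv q (PP u j k)
  have e : PP u j (k+1) = C (2*(u + Complex.I*q)) * PP u j k + (C (-2*(j:ℂ)) * PP u (j-1) k
     + C (-1) * (derivative (PP u j k) + (C (2*Complex.I*q) - 2 * X) * PP u j k)) := by
    unfold PP
    rw [derivative_mul, derivative_comp, derivative_comp, Hp_succ, Hp_deriv', Hp_deriv']
    simp
    have : (C (2:ℂ)) = (2 : ℂ[X]) := rfl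
    rw [this]
    ring
  rw [e, J_add, J_add, J_C, J_C, J_C, h]
  ring

lemma rec2 (u q : ℝ) (j : ℕ) :
    J q (PP u (j+1) 0) = 2*(u - Complex.I*q) * J q (PP u j 0) := by
  have h := J_deriv q (PP u j 0)
  have e : PP u (j+1) 0 = C (2*(u - Complex.I*q)) * PP u j 0
     + (derivative (PP u j 0) + (C (2*Complex.I*q) - 2 * X) * PP u j 0) := by
    unfold PP
    rw [derivative_mul, derivative_comp, derivative_comp, Hp_succ, Hp_deriv', Hp_deriv']
    simp
    have : (C (2:ℂ)) = (2 : ℂ[X]) := rfl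
    rw [this]
    ring
  rw [e, J_add, J_C, h]
  ring

/-- The closed form. -/
noncomputable def F (z w : ℂ) (j k : ℕ) : ℂ :=
  ∑ m ∈ Finset.range (j+1), (j.descFactorial m : ℂ) * (k.choose m : ℂ) * (-2)^m * (2*z)^(k-m) * (2*w)^(j-m)

lemma F_zero (z w : ℂ) (j : ℕ) : F z w j 0 = (2*w)^j := by
  unfold F
  rw [Finset.sum_range_succ']
  simp

lemma F_rec (z w : ℂ) (j k : ℕ) : F z w j (k+1) = 2*z*F z w j k - 2*j*F z w (j-1) k := by
  cases j with
  | zero => simp [F]; ring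
  | succ j =>
    unfold F
    rw [Finset.sum_range_succ' _ (j+1), Finset.sum_range_succ' _ (j+1)]
    simp only [Nat.add_sub_cancel]
    rw [mul_add, Finset.mul_sum, Finset.mul_sum]
    have : ∀ m ∈ Finset.range (j+1), ((j+1).descFactorial (m+1) : ℂ) * ((k+1).choose (m+1) : ℂ) * (-2)^(m+1) * (2*z)^(k+1-(m+1)) * (2*w)^(j+1-(m+1))
       = 2*z*(((j+1).descFactorial (m+1) : ℂ) * (k.choose (m+1) : ℂ) * (-2)^(m+1) * (2*z)^(k-(m+1)) * (2*w)^(j+1-(m+1)))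
        - 2*((j+1:ℕ):ℂ)*((j.descFactorial m : ℂ) * (k.choose m : ℂ) * (-2)^m * (2*z)^(k-m) * (2*w)^(j-m)) := by
      intro m _
      rw [Nat.succ_descFactorial_succ, Nat.choose_succ_succ]
      simp only [Nat.add_sub_add_right]
      rcases lt_or_ge m k with hm | hm
      · obtain ⟨d, rfl⟩ := Nat.exists_eq_add_of_lt hm
        rw [show m + d + 1 - m = d + 1 by omega, show m + d + 1 - (m+1) = d by omega]
        push_cast
        ring
      · rw [Nat.choose_eq_zero_of_lt (show k < m + 1 by omega)]
        push_cast
        ring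
    rw [Finset.sum_congr rfl this, Finset.sum_sub_distrib]
    simp
    ring

lemma J_PP (u q : ℝ) (j k : ℕ) :
    J q (PP u j k) = F (u + Complex.I*q) (u - Complex.I*q) j k * J q 1 := by
  induction k generalizing j with
  | zero =>
    rw [F_zero]
    induction j with
    | zero => simp [PP, Hp]
    | succ j ih => rw [rec2, ih]; ring
  | succ k ih => rw [rec1, ih, ih, F_rec]; ring

lemma F_lag (z w : ℂ) (y : ℝ) (hy : 2 * (z * w) = y) (j d : ℕ) :
    F z w j (j+d) = (2*z)^d * (-2)^j * (j.factorial : ℂ) * ((laguerreL d j y : ℝ) : ℂ) := by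
  unfold F laguerreL
  rw [← Finset.sum_range_reflect]
  push_cast
  rw [Finset.mul_sum]
  refine Finset.sum_congr rfl fun m hm => ?_
  have hm : m ≤ j := by simpa [Nat.lt_succ_iff] using hm
  obtain ⟨n, rfl⟩ := Nat.exists_eq_add_of_le hm
  rw [show m + n - m = n by omega,
    show m + n + d - n = m + d by omega, Nat.add_sub_cancel, ← hy]
  have h1 : ((m+n).descFactorial n : ℂ) = (m+n).factorial / m.factorial := by
    rw [eq_div_iff (by exact_mod_cast m.factorial_ne_zero)]
    have := Nat.factorial_mul_descFactorial (n := m+n) (k := n) (by omega)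
    rw [Nat.add_sub_cancel] at this
    rw [mul_comm]; exact_mod_cast this
  have h2 : ((m+n+d).choose n : ℂ) = (m+n+d).factorial / (n.factorial * (d+m).factorial) := by
    rw [Nat.cast_choose ℂ (show n ≤ m+n+d by omega), show m+n+d-n = d+m by omega]
  rw [h1, h2]
  have e1 : ((-2:ℂ))^(m+n) * (-(2*(z*w)))^m = (-2)^n * (2*z)^m * (2*w)^m := by
    rw [pow_add, mul_right_comm, ← mul_pow, mul_assoc ((-2:ℂ)^n), ← mul_pow, mul_comm]
    congr 2; ring
  rw [pow_add (2*z)]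
  linear_combination (-(((m+n).factorial:ℂ) / m.factorial * ((m+n+d).factorial / (n.factorial * (d+m).factorial)) * (2*z)^d)) * e1

end Groen

/-- Groenewold's formula: for `0 ≤ j ≤ k`,
`∫ ℏ ψ_j^ℏ(x-ℏy/2) ψ_k^ℏ(x+ℏy/2) e^{ipy} dy
  = 2 √((2/ℏ)^{k-j} j!/k!) (x+ip)^{k-j} e^{-(p²+x²)/ℏ} (-1)^j L_j^{(k-j)}(2(p²+x²)/ℏ)`. -/
theorem groenewold_formula (hbar : ℝ) (hh : 0 < hbar) (j k : ℕ) (hjk : j ≤ k) (x p : ℝ) :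
    (∫ y : ℝ, ((hbar * psiH hbar j (x - hbar*y/2) * psiH hbar k (x + hbar*y/2) : ℝ) : ℂ) *
        Complex.exp (Complex.I * (p:ℂ) * (y:ℂ)))
      = 2 * ((Real.sqrt ((2/hbar)^(k-j) * (Nat.factorial j) / (Nat.factorial k)) : ℝ) : ℂ) *
        ((x : ℂ) + Complex.I * (p : ℂ))^(k-j) *
        ((Real.exp (-(p^2+x^2)/hbar) : ℝ) : ℂ) *
        (((-1:ℝ)^j * laguerreL (k-j) j (2*(p^2+x^2)/hbar) : ℝ) : ℂ) := by
  obtain ⟨d, rfl⟩ := Nat.exists_eq_add_of_le hjk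
  rw [Nat.add_sub_cancel_left]
  obtain ⟨r, hr, rfl⟩ : ∃ r : ℝ, 0 < r ∧ hbar = r^2 :=
    ⟨Real.sqrt hbar, Real.sqrt_pos.2 hh, (Real.sq_sqrt hh.le).symm⟩
  have hrC : (r:ℂ) ≠ 0 := by exact_mod_cast hr.ne'
  have hsr : Real.sqrt (r^2) = r := Real.sqrt_sq hr.le
  set cj : ℝ := (Real.sqrt (Real.sqrt Real.pi * 2^j * (Nat.factorial j) * r))⁻¹ with hcj
  set ck : ℝ := (Real.sqrt (Real.sqrt Real.pi * 2^(j+d) * (Nat.factorial (j+d)) * r))⁻¹ with hck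
  have hint : ∀ y : ℝ, ((r^2 * psiH (r^2) j (x - r^2*y/2) * psiH (r^2) (j+d) (x + r^2*y/2) : ℝ) : ℂ) *
        Complex.exp (Complex.I * (p:ℂ) * (y:ℂ)) =
      ((r^2 * cj * ck : ℝ) : ℂ) * Complex.exp (-((x/r : ℝ):ℂ)^2) *
        (fun s : ℝ => (Groen.PP (x/r) j (j+d)).eval (s:ℂ) * Groen.W (p/r) s) (r/2 * y) := by
    intro y
    unfold psiH
    rw [hsr, ← hcj, ← hck]
    simp only [Groen.PP, Groen.W]
    push_cast
    rw [Groen.hermiteH_eq, Groen.hermiteH_eq]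
    simp only [Polynomial.eval_mul, Polynomial.eval_comp, Polynomial.eval_sub, Polynomial.eval_add,
      Polynomial.eval_C, Polynomial.eval_X]
    have e1 : (((x - r^2*y/2)/r : ℝ) : ℂ) = (x:ℂ)/r - r/2*y := by
      push_cast; field_simp
    have e2 : (((x + r^2*y/2)/r : ℝ) : ℂ) = (x:ℂ)/r + r/2*y := by
      push_cast; field_simp
    rw [e1, e2]
    have e3 : Complex.exp (-((x:ℂ) - r^2*y/2)^2/(2*r^2)) * Complex.exp (-((x:ℂ) + r^2*y/2)^2/(2*r^2)) *
       Complex.exp (Complex.I * (p:ℂ) * (y:ℂ)) = Complex.exp (-((x:ℂ)/r)^2) *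
        Complex.exp (-((r:ℂ)/2*y)^2 + 2*Complex.I*(p/r)*(r/2*y)) := by
      rw [← Complex.exp_add, ← Complex.exp_add, ← Complex.exp_add]
      congr 1
      field_simp
      ring
    linear_combination ((r:ℂ)^2 * cj * ck * (Groen.Hp j).eval ((x:ℂ)/r - r/2*y) * (Groen.Hp (j+d)).eval ((x:ℂ)/r + r/2*y)) * e3
  simp_rw [hint]
  rw [integral_const_mul, Measure.integral_comp_mul_left
    (fun s : ℝ => (Groen.PP (x/r) j (j+d)).eval (s:ℂ) * Groen.W (p/r) s) (r/2)]
  change _ * (_ • Groen.J (p/r) (Groen.PP (x/r) j (j+d))) = _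
  rw [Groen.J_PP, Groen.J_one, Groen.F_lag _ _ (2*(p^2+x^2)/r^2)]
  swap
  · push_cast
    field_simp
    linear_combination (-(p:ℂ)^2) * Complex.I_sq
  have hE : Complex.exp (-((x/r : ℝ):ℂ)^2) * Complex.exp (-((p/r : ℝ):ℂ)^2) =
      ((Real.exp (-(p^2+x^2)/r^2) : ℝ) : ℂ) := by
    rw [← Complex.exp_add]
    push_cast
    congr 1
    field_simp
    ring
  have hz : 2 * (((x/r:ℝ):ℂ) + Complex.I * ((p/r:ℝ):ℂ)) = ((2/r:ℝ):ℂ) * ((x:ℂ) + Complex.I * p) := by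
    push_cast; field_simp
  have hreal : r^2 * cj * ck * |(r/2)⁻¹| * Real.sqrt Real.pi * (2/r)^d * 2^j * j.factorial
      = 2 * Real.sqrt ((2/r^2)^d * (Nat.factorial j) / (Nat.factorial (j+d))) := by
    have hpi : 0 < Real.sqrt Real.pi := Real.sqrt_pos.2 Real.pi_pos
    have hfj : (0:ℝ) < j.factorial := by exact_mod_cast j.factorial_pos
    have hfk : (0:ℝ) < (j+d).factorial := by exact_mod_cast (j+d).factorial_pos
    rw [abs_of_pos (by positivity)]
    have hcj2 : cj^2 = (Real.sqrt Real.pi * 2^j * (Nat.factorial j) * r)⁻¹ := by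
      rw [hcj, inv_pow, Real.sq_sqrt (by positivity)]
    have hck2 : ck^2 = (Real.sqrt Real.pi * 2^(j+d) * (Nat.factorial (j+d)) * r)⁻¹ := by
      rw [hck, inv_pow, Real.sq_sqrt (by positivity)]
    have hcj0 : 0 ≤ cj := by positivity
    have hck0 : 0 ≤ ck := by positivity
    rw [← sq_eq_sq₀ (by positivity) (by positivity)]
    simp only [mul_pow]
    rw [hcj2, hck2, Real.sq_sqrt
      (show 0 ≤ (2/r^2)^d * (Nat.factorial j : ℝ) / (Nat.factorial (j+d)) by positivity)]
    simp only [div_pow, inv_pow, pow_add]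
    field_simp
    ring
  have hrealC := congrArg (fun t : ℝ => (t:ℂ)) hreal
  rw [hz, Complex.real_smul, mul_pow, ← hE]
  have hneg : (-2:ℂ)^j = (-1)^j * 2^j := by rw [← mul_pow]; norm_num
  rw [hneg]
  push_cast at hrealC ⊢
  linear_combination (((x:ℂ) + Complex.I * p)^d * (-1)^j * ((laguerreL d j (2*(p^2+x^2)/r^2) : ℝ):ℂ)
    * Complex.exp (-((x:ℂ)/r)^2) * Complex.exp (-((p:ℂ)/r)^2)) * hrealC
end
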